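/- arXiv:0908.3592 — 2 statements merged into one kernel-verified Lean document; each statement's English description precedes it below -/
import Mathlib

section
/- Ricci identity (vertical components, spatial–spatial derivatives): for any smooth d-vector components X¹, X^i, X^{(i)} : E → ℝ and all i, j, k, one has X^{(i)}_{|j|k} − X^{(i)}_{|k|j} = Σ_r X^{(r)} Rv^i_{rjk} − Σ_r X^{(i)}_{|r} T^r_{jk} − Σ_r X^{(i)}|_{(r)} R^r_{jk}, where T^r_{jk} := L^r_{jk} − L^r_{kj}, R^r_{jk} := δN^r_j/δx^k − δN^r_k/δx^j, and Rv^i_{rjk} := δLv^i_{rj}/δx^k − δLv^i_{rk}/δx^j + Σ_s (Lv^s_{rj} Lv^i_{sk} − Lv^s_{rk} Lv^i_{sj}) + Σ_s Cv^i_{rs} R^s_{jk}. -/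
noncomputable section
open scoped BigOperators

/-- The local model `E = ℝ × (Fin n → ℝ) × (Fin n → ℝ)` of the 1-jet space `J¹(ℝ,M)`,
with coordinates `(t, x, y)`. -/
abbrev E (n : ℕ) : Type := ℝ × (Fin n → ℝ) × (Fin n → ℝ)

variable {n : ℕ}

/-- Partial derivative `∂f/∂t`. -/
def pT (f : E n → ℝ) (p : E n) : ℝ := fderiv ℝ f p (1, 0, 0)

/-- Partial derivative `∂f/∂x^i`. -/
def pX (f : E n → ℝ) (i : Fin n) (p : E n) : ℝ := fderiv ℝ f p (0, Pi.single i 1, 0)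

/-- Partial derivative `∂f/∂y^i`. -/
def pY (f : E n → ℝ) (i : Fin n) (p : E n) : ℝ := fderiv ℝ f p (0, 0, Pi.single i 1)

/-- The adapted temporal frame field `δ/δt = ∂/∂t - Σ_j M^j ∂/∂y^j`. -/
def delT (M : E n → Fin n → ℝ) (p : E n) : E n := (1, 0, fun j => -(M p j))

/-- The adapted spatial frame field `δ/δx^i = ∂/∂x^i - Σ_j N^j_i ∂/∂y^j`. -/
def delX (N : E n → Fin n → Fin n → ℝ) (i : Fin n) (p : E n) : E n :=
  (0, Pi.single i 1, fun j => -(N p i j))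

/-- The vertical frame field `∂/∂y^i`. -/
def delY (i : Fin n) (p : E n) : E n := ((0 : ℝ), (0 : Fin n → ℝ), Pi.single i 1)

/-- The Lie bracket `[X,Y](p) = (DY)(p)(X(p)) - (DX)(p)(Y(p))` of vector fields on `E`. -/
def lieBr (X Y : E n → E n) (p : E n) : E n := fderiv ℝ Y p (X p) - fderiv ℝ X p (Y p)

/-- `δf/δt := ∂f/∂t - Σ_k M^k ∂f/∂y^k`. -/
def dT (M : E n → Fin n → ℝ) (f : E n → ℝ) (p : E n) : ℝ :=
  pT f p - ∑ k, M p k * pY f k p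

/-- `δf/δx^i := ∂f/∂x^i - Σ_k N^k_i ∂f/∂y^k`. -/
def dX (N : E n → Fin n → Fin n → ℝ) (f : E n → ℝ) (i : Fin n) (p : E n) : ℝ :=
  pX f i p - ∑ k, N p i k * pY f k p

/-- The nine families of adapted coefficients of a Γ-linear connection `∇`. -/
structure Conn (n : ℕ) where
  Gbar : E n → ℝ
  G : E n → Fin n → Fin n → ℝ
  Gv : E n → Fin n → Fin n → ℝ
  Lbar : E n → Fin n → ℝ
  L : E n → Fin n → Fin n → Fin n → ℝ
  Lv : E n → Fin n → Fin n → Fin n → ℝ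
  Cbar : E n → Fin n → ℝ
  C : E n → Fin n → Fin n → Fin n → ℝ
  Cv : E n → Fin n → Fin n → Fin n → ℝ

/-- All nine coefficient families are smooth. -/
def Conn.Smooth (K : Conn n) : Prop :=
  ContDiff ℝ (⊤ : ℕ∞) K.Gbar ∧ ContDiff ℝ (⊤ : ℕ∞) K.G ∧ ContDiff ℝ (⊤ : ℕ∞) K.Gv ∧ ContDiff ℝ (⊤ : ℕ∞) K.Lbar ∧
  ContDiff ℝ (⊤ : ℕ∞) K.L ∧ ContDiff ℝ (⊤ : ℕ∞) K.Lv ∧ ContDiff ℝ (⊤ : ℕ∞) K.Cbar ∧ ContDiff ℝ (⊤ : ℕ∞) K.C ∧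
  ContDiff ℝ (⊤ : ℕ∞) K.Cv

/-- `X^i_{/1} := δX^i/δt + Σ_r X^r G^i_r`. -/
def covTx (M : E n → Fin n → ℝ) (K : Conn n) (Xs : E n → Fin n → ℝ) (i : Fin n)
    (p : E n) : ℝ :=
  dT M (fun q => Xs q i) p + ∑ r, Xs p r * K.G p i r

/-- `X^i_{|j} := δX^i/δx^j + Σ_r X^r L^i_{rj}`. -/
def covXx (N : E n → Fin n → Fin n → ℝ) (K : Conn n) (Xs : E n → Fin n → ℝ) (i j : Fin n)
    (p : E n) : ℝ :=
  dX N (fun q => Xs q i) j p + ∑ r, Xs p r * K.L p i r j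

/-- `X^i|_{(j)} := ∂X^i/∂y^j + Σ_r X^r C^i_{rj}`. -/
def covYx (K : Conn n) (Xs : E n → Fin n → ℝ) (i j : Fin n) (p : E n) : ℝ :=
  pY (fun q => Xs q i) j p + ∑ r, Xs p r * K.C p i r j

/-- `X^{(i)}_{/1} := δX^{(i)}/δt + Σ_r X^{(r)} Gv^i_r`. -/
def covTv (M : E n → Fin n → ℝ) (K : Conn n) (Xv : E n → Fin n → ℝ) (i : Fin n)
    (p : E n) : ℝ :=
  dT M (fun q => Xv q i) p + ∑ r, Xv p r * K.Gv p i r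

/-- `X^{(i)}_{|j} := δX^{(i)}/δx^j + Σ_r X^{(r)} Lv^i_{rj}`. -/
def covXv (N : E n → Fin n → Fin n → ℝ) (K : Conn n) (Xv : E n → Fin n → ℝ) (i j : Fin n)
    (p : E n) : ℝ :=
  dX N (fun q => Xv q i) j p + ∑ r, Xv p r * K.Lv p i r j

/-- `X^{(i)}|_{(j)} := ∂X^{(i)}/∂y^j + Σ_r X^{(r)} Cv^i_{rj}`. -/
def covYv (K : Conn n) (Xv : E n → Fin n → ℝ) (i j : Fin n) (p : E n) : ℝ :=
  pY (fun q => Xv q i) j p + ∑ r, Xv p r * K.Cv p i r j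

/-- The d-tensor `R^r_{1k} := δM^r/δx^k − δN^r_k/δt`. -/
def Rtime (M : E n → Fin n → ℝ) (N : E n → Fin n → Fin n → ℝ) (r k : Fin n) (p : E n) : ℝ :=
  dX N (fun q => M q r) k p - dT M (fun q => N q k r) p

/-- The d-tensor `R^r_{jk} := δN^r_j/δx^k − δN^r_k/δx^j`. -/
def Rspace (N : E n → Fin n → Fin n → ℝ) (r j k : Fin n) (p : E n) : ℝ :=
  dX N (fun q => N q j r) k p - dX N (fun q => N q k r) j p

/-- Second covariant derivative `X^{(i)}_{|j|k} := δ(X^{(i)}_{|j})/δx^k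
+ Σ_r X^{(r)}_{|j} Lv^i_{rk} − Σ_r X^{(i)}_{|r} L^r_{jk}`. -/
def covXvX (N : E n → Fin n → Fin n → ℝ) (K : Conn n) (Xv : E n → Fin n → ℝ)
    (i j k : Fin n) (p : E n) : ℝ :=
  dX N (fun q => covXv N K Xv i j q) k p + (∑ r, covXv N K Xv r j p * K.Lv p i r k)
    - ∑ r, covXv N K Xv i r p * K.L p r j k

/-- The vertical curvature d-tensor `Rv^i_{rjk} := δLv^i_{rj}/δx^k − δLv^i_{rk}/δx^j
+ Σ_s (Lv^s_{rj} Lv^i_{sk} − Lv^s_{rk} Lv^i_{sj}) + Σ_s Cv^i_{rs} R^s_{jk}`. -/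
def RvCurv (N : E n → Fin n → Fin n → ℝ) (K : Conn n) (i r j k : Fin n) (p : E n) : ℝ :=
  dX N (fun q => K.Lv q i r j) k p - dX N (fun q => K.Lv q i r k) j p
    + (∑ s, (K.Lv p s r j * K.Lv p i s k - K.Lv p s r k * K.Lv p i s j))
    + ∑ s, K.Cv p i r s * Rspace N s j k p

/-- `δf/δx^i` is the derivative of `f` along the adapted frame field. -/
theorem dX_eq_fderiv (N : E n → Fin n → Fin n → ℝ) (f : E n → ℝ) (i : Fin n) (p : E n) :
    dX N f i p = fderiv ℝ f p (delX N i p) := by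
  have h : delX N i p = ((0, Pi.single i 1, 0) : E n) -
      ∑ k, N p i k • ((0, 0, Pi.single k 1) : E n) := by
    refine Prod.ext ?_ (Prod.ext ?_ ?_)
    · simp [delX, Prod.fst_sum]
    · simp [delX, Prod.fst_sum, Prod.snd_sum]
    · ext l
      simp [delX, Prod.snd_sum, Finset.sum_apply, Pi.single_apply]
  simp only [h, map_sub, map_sum, map_smul, dX, pX, pY, smul_eq_mul]

/-- The derivative along a vertical vector in terms of the partial derivatives `∂f/∂y^r`. -/
theorem fderiv_vertical (f : E n → ℝ) (p : E n) (w : Fin n → ℝ) :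
    fderiv ℝ f p (0, 0, w) = ∑ r, w r * pY f r p := by
  have h : ((0, 0, w) : E n) = ∑ r, w r • ((0, 0, Pi.single r 1) : E n) := by
    refine Prod.ext ?_ (Prod.ext ?_ ?_)
    · simp [Prod.fst_sum]
    · simp [Prod.fst_sum, Prod.snd_sum]
    · ext l
      simp [Prod.snd_sum, Finset.sum_apply, Pi.single_apply]
  simp only [h, map_sum, map_smul, pY, smul_eq_mul]

theorem dX_add (N : E n → Fin n → Fin n → ℝ) {f g : E n → ℝ} {p : E n}
    (hf : DifferentiableAt ℝ f p) (hg : DifferentiableAt ℝ g p) (i : Fin n) :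
    dX N (fun q => f q + g q) i p = dX N f i p + dX N g i p := by
  simp only [dX_eq_fderiv, fderiv_fun_add hf hg, add_apply]

theorem dX_sum_mul (N : E n → Fin n → Fin n → ℝ) {f g : Fin n → E n → ℝ} {p : E n}
    (hf : ∀ r, DifferentiableAt ℝ (f r) p) (hg : ∀ r, DifferentiableAt ℝ (g r) p) (i : Fin n) :
    dX N (fun q => ∑ r, f r q * g r q) i p =
      ∑ r, (dX N (f r) i p * g r p + f r p * dX N (g r) i p) := by
  simp only [dX_eq_fderiv]
  rw [fderiv_fun_sum fun r _ => (hf r).fun_mul (hg r), sum_apply]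
  refine Finset.sum_congr rfl fun r _ => ?_
  rw [fderiv_fun_mul (hf r) (hg r)]
  simp only [add_apply, smul_apply, smul_eq_mul]
  ring

theorem hasFDerivAt_delX {N : E n → Fin n → Fin n → ℝ} {p : E n} {j : Fin n}
    (hN : ∀ r, DifferentiableAt ℝ (fun q => N q j r) p) :
    HasFDerivAt (delX N j)
      ((0 : E n →L[ℝ] ℝ).prod ((0 : E n →L[ℝ] (Fin n → ℝ)).prod
        (ContinuousLinearMap.pi fun r => -fderiv ℝ (fun q => N q j r) p))) p :=
  (hasFDerivAt_const _ _).prodMk ((hasFDerivAt_const _ _).prodMk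
    (hasFDerivAt_pi.2 fun r => (hN r).hasFDerivAt.neg))

theorem differentiableAt_dX {N : E n → Fin n → Fin n → ℝ} {f : E n → ℝ} {p : E n} {j : Fin n}
    (hN : ∀ r, DifferentiableAt ℝ (fun q => N q j r) p) (hf : ContDiffAt ℝ 2 f p) :
    DifferentiableAt ℝ (fun q => dX N f j q) p := by
  simp only [dX_eq_fderiv]
  exact ((hf.fderiv_right (m := 1) (by norm_num)).differentiableAt (by norm_num)).clm_apply
    (hasFDerivAt_delX hN).differentiableAt

/-- The second derivative along adapted frame fields. -/
theorem dX_dX {N : E n → Fin n → Fin n → ℝ} {f : E n → ℝ} {p : E n} {j : Fin n}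
    (hN : ∀ r, DifferentiableAt ℝ (fun q => N q j r) p) (hf : ContDiffAt ℝ 2 f p) (k : Fin n) :
    dX N (fun q => dX N f j q) k p =
      fderiv ℝ (fderiv ℝ f) p (delX N k p) (delX N j p) -
        ∑ r, dX N (fun q => N q j r) k p * pY f r p := by
  have hd : DifferentiableAt ℝ (fderiv ℝ f) p :=
    (hf.fderiv_right (m := 1) (by norm_num)).differentiableAt (by norm_num)
  have hv := hasFDerivAt_delX hN
  rw [dX_eq_fderiv]
  simp only [dX_eq_fderiv N f]
  rw [fderiv_clm_apply hd hv.differentiableAt, hv.fderiv]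
  have hw := fderiv_vertical f p fun r => -fderiv ℝ (fun q => N q j r) p (delX N k p)
  simp only [neg_mul, Finset.sum_neg_distrib] at hw
  simp only [dX_eq_fderiv, sub_eq_add_neg]
  rw [← hw, add_comm]
  rfl

/-- The commutator `[δ/δx^k, δ/δx^j] = -Σ_r R^r_{jk} ∂/∂y^r`. -/
theorem dX_comm {N : E n → Fin n → Fin n → ℝ} {f : E n → ℝ} {p : E n}
    (hN : ∀ j r, DifferentiableAt ℝ (fun q => N q j r) p) (hf : ContDiffAt ℝ 2 f p)
    (j k : Fin n) :
    dX N (fun q => dX N f j q) k p - dX N (fun q => dX N f k q) j p =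
      -∑ r, pY f r p * Rspace N r j k p := by
  have hs : IsSymmSndFDerivAt ℝ f p := hf.isSymmSndFDerivAt (by simp)
  rw [dX_dX (hN j) hf, dX_dX (hN k) hf, hs.eq (delX N k p) (delX N j p), sub_sub_sub_cancel_left,
    ← Finset.sum_sub_distrib, ← Finset.sum_neg_distrib]
  refine Finset.sum_congr rfl fun r _ => ?_
  rw [Rspace]
  ring

theorem dX_covXv {N : E n → Fin n → Fin n → ℝ} {K : Conn n} {Xv : E n → Fin n → ℝ} {p : E n}
    (hN : ∀ j r, DifferentiableAt ℝ (fun q => N q j r) p)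
    (hL : ∀ i r j, DifferentiableAt ℝ (fun q => K.Lv q i r j) p)
    (hX : ∀ r, ContDiffAt ℝ 2 (fun q => Xv q r) p) (i j k : Fin n) :
    dX N (fun q => covXv N K Xv i j q) k p =
      dX N (fun q => dX N (fun q => Xv q i) j q) k p +
        ∑ r, (dX N (fun q => Xv q r) k p * K.Lv p i r j +
          Xv p r * dX N (fun q => K.Lv q i r j) k p) := by
  have hX' : ∀ r, DifferentiableAt ℝ (fun q => Xv q r) p :=
    fun r => (hX r).differentiableAt (by norm_num)
  simp only [covXv]
  rw [dX_add N (differentiableAt_dX (hN j) (hX i))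
    (DifferentiableAt.fun_sum fun r _ => (hX' r).fun_mul (hL i r j)),
    dX_sum_mul N hX' fun r => hL i r j]

/-- Ricci identity, vertical components, spatial–spatial derivatives:
`X^{(i)}_{|j|k} − X^{(i)}_{|k|j} = Σ_r X^{(r)} Rv^i_{rjk} − Σ_r X^{(i)}_{|r} T^r_{jk}
− Σ_r X^{(i)}|_{(r)} R^r_{jk}`, where `T^r_{jk} := L^r_{jk} − L^r_{kj}`. -/
theorem ricci_v_space_space (n : ℕ) (M : E n → Fin n → ℝ) (N : E n → Fin n → Fin n → ℝ)
    (hM : ContDiff ℝ (⊤ : ℕ∞) M) (hN : ContDiff ℝ (⊤ : ℕ∞) N) (K : Conn n) (hK : K.Smooth)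
    (X1 : E n → ℝ) (Xs Xv : E n → Fin n → ℝ)
    (hX1 : ContDiff ℝ (⊤ : ℕ∞) X1) (hXs : ContDiff ℝ (⊤ : ℕ∞) Xs) (hXv : ContDiff ℝ (⊤ : ℕ∞) Xv)
    (i j k : Fin n) (p : E n) :
    covXvX N K Xv i j k p - covXvX N K Xv i k j p =
      (∑ r, Xv p r * RvCurv N K i r j k p)
        - (∑ r, covXv N K Xv i r p * (K.L p r j k - K.L p r k j))
        - ∑ r, covYv K Xv i r p * Rspace N r j k p := by
  have hN' : ∀ j r, DifferentiableAt ℝ (fun q => N q j r) p := fun j r =>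
    (contDiff_pi.1 (contDiff_pi.1 hN j) r).contDiffAt.differentiableAt (by simp)
  have hL : ∀ i r j, DifferentiableAt ℝ (fun q => K.Lv q i r j) p := fun i r j =>
    (contDiff_pi.1 (contDiff_pi.1 (contDiff_pi.1 hK.2.2.2.2.2.1 i) r)
      j).contDiffAt.differentiableAt (by simp)
  have hX : ∀ r, ContDiffAt ℝ 2 (fun q => Xv q r) p := fun r =>
    ((contDiff_pi.1 hXv r).of_le (WithTop.coe_le_coe.2 le_top)).contDiffAt
  have hcomm := dX_comm hN' (hX i) j k
  have hquad (j k : Fin n) : ∑ r, (∑ s, Xv p s * K.Lv p r s j) * K.Lv p i r k =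
      ∑ r, Xv p r * ∑ s, K.Lv p s r j * K.Lv p i s k := by
    simp only [Finset.sum_mul, Finset.mul_sum]
    rw [Finset.sum_comm]
    simp only [mul_assoc]
  have hvert : ∑ r, (∑ s, Xv p s * K.Cv p i s r) * Rspace N r j k p =
      ∑ r, Xv p r * ∑ s, K.Cv p i r s * Rspace N s j k p := by
    simp only [Finset.sum_mul, Finset.mul_sum]
    rw [Finset.sum_comm]
    simp only [mul_assoc]
  have hcov (j k : Fin n) : ∑ r, covXv N K Xv r j p * K.Lv p i r k =
      ∑ r, dX N (fun q => Xv q r) j p * K.Lv p i r k +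
        ∑ r, Xv p r * ∑ s, K.Lv p s r j * K.Lv p i s k := by
    rw [← hquad]
    simp only [covXv, add_mul, Finset.sum_add_distrib]
  have hcovY : ∑ r, covYv K Xv i r p * Rspace N r j k p =
      ∑ r, pY (fun q => Xv q i) r p * Rspace N r j k p +
        ∑ r, Xv p r * ∑ s, K.Cv p i r s * Rspace N s j k p := by
    rw [← hvert]
    simp only [covYv, add_mul, Finset.sum_add_distrib]
  rw [covXvX, covXvX, dX_covXv hN' hL hX, dX_covXv hN' hL hX, hcov, hcov, hcovY]
  simp only [RvCurv, mul_add, mul_sub, Finset.sum_add_distrib, Finset.sum_sub_distrib]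
  linear_combination hcomm
end
end

section
/- Deflection d-tensor identity: for all i, j, k, the deflection d-tensors of the Γ-linear connection ∇ satisfy D^{(i)}_{j|k} − D^{(i)}_{k|j} = Σ_r y^r Rv^i_{rjk} − Σ_r D^{(i)}_r T^r_{jk} − Σ_r d^{(i)}_{(r)} R^r_{jk}, where T^r_{jk} := L^r_{jk} − L^r_{kj}, R^r_{jk} := δN^r_j/δx^k − δN^r_k/δx^j, and Rv^i_{rjk} := δLv^i_{rj}/δx^k − δLv^i_{rk}/δx^j + Σ_s (Lv^s_{rj} Lv^i_{sk} − Lv^s_{rk} Lv^i_{sj}) + Σ_s Cv^i_{rs} R^s_{jk}. -/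
noncomputable section
open scoped BigOperators

variable {n : ℕ}

/-- The canonical Liouville d-tensor field `C^{(i)}(t,x,y) := y^i`. -/
def liouville : E n → Fin n → ℝ := fun p => p.2.2

/-- The deflection d-tensor `D^{(i)}_j := δy^i/δx^j + Σ_r y^r Lv^i_{rj}`. -/
def defl (N : E n → Fin n → Fin n → ℝ) (K : Conn n) (i j : Fin n) (p : E n) : ℝ :=
  covXv N K liouville i j p

/-- The deflection d-tensor `d^{(i)}_{(j)} := ∂y^i/∂y^j + Σ_r y^r Cv^i_{rj}`. -/
def defld (K : Conn n) (i j : Fin n) (p : E n) : ℝ :=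
  covYv K liouville i j p

/-- Second covariant derivative
`D^{(i)}_{j|k} := δ(D^{(i)}_j)/δx^k + Σ_r D^{(r)}_j Lv^i_{rk} − Σ_r D^{(i)}_r L^r_{jk}`. -/
def deflX (N : E n → Fin n → Fin n → ℝ) (K : Conn n) (i j k : Fin n) (p : E n) : ℝ :=
  dX N (fun q => defl N K i j q) k p + (∑ r, defl N K r j p * K.Lv p i r k)
    - ∑ r, defl N K i r p * K.L p r j k

theorem hasFDerivAt_fiber_coord (r : Fin n) (p : E n) :
    HasFDerivAt (fun q : E n => q.2.2 r)
      ((ContinuousLinearMap.proj (R := ℝ) (φ := fun _ : Fin n => ℝ) r).comp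
        ((ContinuousLinearMap.snd ℝ (Fin n → ℝ) (Fin n → ℝ)).comp
          (ContinuousLinearMap.snd ℝ ℝ ((Fin n → ℝ) × (Fin n → ℝ))))) p :=
  ((ContinuousLinearMap.proj (R := ℝ) (φ := fun _ : Fin n => ℝ) r).comp
    ((ContinuousLinearMap.snd ℝ (Fin n → ℝ) (Fin n → ℝ)).comp
      (ContinuousLinearMap.snd ℝ ℝ ((Fin n → ℝ) × (Fin n → ℝ))))).hasFDerivAt

theorem dX_fiber_coord (N : E n → Fin n → Fin n → ℝ) (r i : Fin n) (p : E n) :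
    dX N (fun q => q.2.2 r) i p = -N p i r := by
  rw [dX_eq_fderiv, (hasFDerivAt_fiber_coord r p).fderiv]
  simp [delX]

theorem pY_fiber_coord (r i : Fin n) (p : E n) :
    pY (fun q => q.2.2 r) i p = if r = i then 1 else 0 := by
  rw [pY, (hasFDerivAt_fiber_coord r p).fderiv]
  simp [Pi.single_apply]

theorem defl_eq (N : E n → Fin n → Fin n → ℝ) (K : Conn n) (i j : Fin n) (p : E n) :
    defl N K i j p = -N p j i + ∑ r, p.2.2 r * K.Lv p i r j := by
  simp only [defl, covXv, liouville, dX_fiber_coord]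

theorem defld_eq (K : Conn n) (i j : Fin n) (p : E n) :
    defld K i j p = (if i = j then 1 else 0) + ∑ r, p.2.2 r * K.Cv p i r j := by
  simp only [defld, covYv, liouville, pY_fiber_coord]

theorem dX_defl (N : E n → Fin n → Fin n → ℝ) (K : Conn n) (hN : Differentiable ℝ N)
    (hLv : Differentiable ℝ K.Lv) (i j k : Fin n) (p : E n) :
    dX N (fun q => defl N K i j q) k p = -dX N (fun q => N q j i) k p
      + ∑ r, (p.2.2 r * dX N (fun q => K.Lv q i r j) k p - N p k r * K.Lv p i r j) := by
  have hN' : DifferentiableAt ℝ (fun q => N q j i) p := by fun_prop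
  have hL (r : Fin n) : DifferentiableAt ℝ (fun q => K.Lv q i r j) p := by fun_prop
  have h := hN'.hasFDerivAt.neg.add
    (HasFDerivAt.fun_sum (u := Finset.univ)
      fun r _ => (hasFDerivAt_fiber_coord r p).mul (hL r).hasFDerivAt)
  rw [dX_eq_fderiv, show (fun q => defl N K i j q)
      = fun q => -N q j i + ∑ r, q.2.2 r * K.Lv q i r j from funext (defl_eq N K i j)]
  refine (congrArg (fun l => l (delX N k p)) h.fderiv).trans ?_
  simp only [dX_eq_fderiv]
  simp [delX, mul_comm, sub_eq_add_neg]

/-- Deflection d-tensor identity: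
`D^{(i)}_{j|k} − D^{(i)}_{k|j} = Σ_r y^r Rv^i_{rjk} − Σ_r D^{(i)}_r T^r_{jk}
− Σ_r d^{(i)}_{(r)} R^r_{jk}`, where `T^r_{jk} := L^r_{jk} − L^r_{kj}`. -/
theorem deflection_identity (n : ℕ) (M : E n → Fin n → ℝ)
    (N : E n → Fin n → Fin n → ℝ)
    (hM : ContDiff ℝ (⊤ : ℕ∞) M) (hN : ContDiff ℝ (⊤ : ℕ∞) N) (K : Conn n) (hK : K.Smooth)
    (i j k : Fin n) (p : E n) :
    deflX N K i j k p - deflX N K i k j p =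
      (∑ r, p.2.2 r * RvCurv N K i r j k p)
        - (∑ r, defl N K i r p * (K.L p r j k - K.L p r k j))
        - ∑ r, defld K i r p * Rspace N r j k p := by
  have dN : Differentiable ℝ N := hN.differentiable (by simp)
  have dLv : Differentiable ℝ K.Lv := hK.2.2.2.2.2.1.differentiable (by simp)
  have hLv (j k : Fin n) : ∑ r, (∑ s, p.2.2 s * K.Lv p r s j) * K.Lv p i r k
      = ∑ r, p.2.2 r * ∑ s, K.Lv p s r j * K.Lv p i s k := by
    simp only [Finset.sum_mul, Finset.mul_sum, mul_assoc]
    exact Finset.sum_comm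
  have hCv : ∑ r, (∑ s, p.2.2 s * K.Cv p i s r) * Rspace N r j k p
      = ∑ r, p.2.2 r * ∑ s, K.Cv p i r s * Rspace N s j k p := by
    simp only [Finset.sum_mul, Finset.mul_sum, mul_assoc]
    exact Finset.sum_comm
  have hdefl (j k : Fin n) : ∑ r, defl N K r j p * K.Lv p i r k
      = -(∑ r, N p j r * K.Lv p i r k)
        + ∑ r, p.2.2 r * ∑ s, K.Lv p s r j * K.Lv p i s k := by
    simp only [defl_eq, add_mul, Finset.sum_add_distrib, hLv, neg_mul, Finset.sum_neg_distrib]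
  have hdefld : ∑ r, defld K i r p * Rspace N r j k p
      = Rspace N i j k p + ∑ r, p.2.2 r * ∑ s, K.Cv p i r s * Rspace N s j k p := by
    simp only [defld_eq, add_mul, Finset.sum_add_distrib, hCv]
    simp
  rw [hdefld]
  simp only [deflX, hdefl, dX_defl N K dN dLv, RvCurv, mul_add, mul_sub,
    Finset.sum_add_distrib, Finset.sum_sub_distrib]
  rw [show Rspace N i j k p = dX N (fun q => N q j i) k p - dX N (fun q => N q k i) j p from rfl]
  ring
end
end
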